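/- Fix α ∈ (0,1) and z > 0. Then for every real s > 0: lim_{n→∞} (∑_{k=1}^{n} 𝒞(n,k;α) (zs)^k) / (∑_{k=1}^{n} 𝒞(n,k;α) z^k) = s · e^{z(s-1)}. Equivalently, the probability generating function of the distribution ρ(·; α,n,z) on {1,…,n} defined by ρ({k}; α,n,z) = 𝒞(n,k;α) z^k / ∑_{j=1}^{n} 𝒞(n,j;α) z^j converges pointwise on (0,∞) to the probability generating function of 1 + N_z, where N_z is Poisson with mean z. -/

import Mathlib

open Real Filter
open scoped BigOperators Topology

/-- Rising factorial `[x]_{(n,a)} = ∏_{i=0}^{n-1} (x + i a)`. -/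
noncomputable def risingFac (x : ℝ) (n : ℕ) (a : ℝ) : ℝ :=
  ∏ i ∈ Finset.range n, (x + i * a)

/-- Generalized factorial coefficient
`𝒞(n,k;α) = (1/k!) ∑_{i=1}^{k} (-1)^i C(k,i) [-iα]_{(n,1)}`. -/
noncomputable def genFacCoeff (n k : ℕ) (α : ℝ) : ℝ :=
  (1 / (Nat.factorial k : ℝ)) *
    ∑ i ∈ Finset.Icc 1 k, (-1 : ℝ) ^ i * (Nat.choose k i : ℝ) * risingFac (-(i : ℝ) * α) n 1

theorem risingFac_succ (x : ℝ) (n : ℕ) :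
    risingFac x (n + 1) 1 = risingFac x n 1 * (x + n) := by
  simp [risingFac, Finset.prod_range_succ]

theorem risingFac_neg_ne_zero {α : ℝ} (hα : α ∈ Set.Ioo (0 : ℝ) 1) (n : ℕ) :
    risingFac (-α) n 1 ≠ 0 := by
  rw [risingFac, Finset.prod_ne_zero_iff]
  intro j _
  have h0 := hα.1
  have h1 := hα.2
  rcases Nat.eq_zero_or_pos j with rfl | hj
  · simpa using h0.ne'
  · have : (1 : ℝ) ≤ j := by exact_mod_cast hj
    have : 0 < -α + j * 1 := by linarith
    exact this.ne'

theorem genFacCoeff_zero_right (n : ℕ) (α : ℝ) : genFacCoeff n 0 α = 0 := by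
  simp [genFacCoeff]

theorem genFacCoeff_one_right (n : ℕ) (α : ℝ) :
    genFacCoeff n 1 α = -risingFac (-α) n 1 := by
  simp [genFacCoeff]

theorem genFacCoeff_one_left_one (α : ℝ) : genFacCoeff 1 1 α = α := by
  simp [genFacCoeff, risingFac]

theorem genFacCoeff_zero_succ (k : ℕ) (α : ℝ) :
    genFacCoeff 0 (k + 1) α = -(1 / (Nat.factorial (k + 1) : ℝ)) := by
  have h : ∑ i ∈ Finset.range (k + 1 + 1), (-1 : ℝ) ^ i * (Nat.choose (k + 1) i : ℝ) = 0 := by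
    have := add_pow (-1 : ℝ) 1 (k + 1)
    simpa using this.symm
  rw [Finset.range_eq_Ico, Finset.sum_eq_sum_Ico_succ_bot (by omega)] at h
  have h' : ∑ i ∈ Finset.Icc 1 (k + 1), (-1 : ℝ) ^ i * (Nat.choose (k + 1) i : ℝ) = -1 := by
    have e : Finset.Icc 1 (k + 1) = Finset.Ico (0 + 1) (k + 1 + 1) := by
      ext; simp
    rw [e]
    simp at h ⊢
    linarith
  simp [genFacCoeff, risingFac, h']

/-- The triangular recurrence of the generalized factorial coefficients. -/
theorem genFacCoeff_succ_succ (n k : ℕ) (α : ℝ) :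
    genFacCoeff (n + 1) (k + 1) α =
      (n - (k + 1) * α) * genFacCoeff n (k + 1) α + α * genFacCoeff n k α := by
  have hk : (Nat.factorial k : ℝ) ≠ 0 := by positivity
  have hk1 : (k + 1 : ℝ) ≠ 0 := by positivity
  have hsub : ∑ i ∈ Finset.Icc 1 k,
      (-1 : ℝ) ^ i * (Nat.choose k i : ℝ) * risingFac (-(i : ℝ) * α) n 1 =
      ∑ i ∈ Finset.Icc 1 (k + 1),
        (-1 : ℝ) ^ i * (Nat.choose k i : ℝ) * risingFac (-(i : ℝ) * α) n 1 := by
    rw [Finset.sum_Icc_succ_top (by omega)]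
    simp
  simp only [genFacCoeff]
  rw [hsub, Nat.factorial_succ]
  simp only [Finset.mul_sum]
  rw [← Finset.sum_add_distrib]
  refine Finset.sum_congr rfl fun i hi => ?_
  have hik : i ≤ k + 1 := (Finset.mem_Icc.mp hi).2
  have hc : ((k : ℝ) + 1) * (Nat.choose k i : ℝ) =
      (Nat.choose (k + 1) i : ℝ) * (k + 1 - i) := by
    have h2 := Nat.choose_mul_succ_eq k i
    have h3 : ((k + 1 - i : ℕ) : ℝ) = k + 1 - i := by
      rw [Nat.cast_sub hik]; push_cast; ring
    rw [← h3, mul_comm]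
    exact_mod_cast h2
  have hc' : (Nat.choose k i : ℝ) = (Nat.choose (k + 1) i : ℝ) * (k + 1 - i) / (k + 1) := by
    rw [← hc]; field_simp
  rw [risingFac_succ, hc']
  push_cast
  field_simp
  ring

theorem genFacCoeff_eq_zero_of_lt (α : ℝ) {n k : ℕ} (hn : 1 ≤ n) (hk : n < k) :
    genFacCoeff n k α = 0 := by
  induction n, hn using Nat.le_induction generalizing k with
  | base =>
    obtain ⟨m, rfl⟩ : ∃ m, k = m + 1 + 1 := ⟨k - 2, by omega⟩
    rw [show (1 : ℕ) = 0 + 1 from rfl, genFacCoeff_succ_succ, genFacCoeff_zero_succ,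
      genFacCoeff_zero_succ, Nat.factorial_succ (m + 1)]
    have : (Nat.factorial (m + 1) : ℝ) ≠ 0 := by positivity
    have : (m + 1 + 1 : ℝ) ≠ 0 := by positivity
    push_cast
    field_simp
    ring
  | succ n hn ih =>
    obtain ⟨m, rfl⟩ : ∃ m, k = m + 1 := ⟨k - 1, by omega⟩
    rw [genFacCoeff_succ_succ, ih (by omega), ih (by omega)]
    ring

theorem genFacCoeff_nonneg {α : ℝ} (hα : α ∈ Set.Ioo (0 : ℝ) 1) {n : ℕ} (hn : 1 ≤ n) (k : ℕ) :
    0 ≤ genFacCoeff n k α := by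
  have h0 := hα.1
  have h1 := hα.2
  induction n, hn using Nat.le_induction generalizing k with
  | base =>
    rcases lt_trichotomy k 1 with h | rfl | h
    · obtain rfl : k = 0 := by omega
      rw [genFacCoeff_zero_right]
    · rw [genFacCoeff_one_left_one]; exact h0.le
    · rw [genFacCoeff_eq_zero_of_lt α le_rfl h]
  | succ n hn ih =>
    rcases k with _ | k
    · rw [genFacCoeff_zero_right]
    · rw [genFacCoeff_succ_succ]
      have hb : 0 ≤ α * genFacCoeff n k α := mul_nonneg h0.le (ih k)
      rcases le_or_gt (k + 1) n with h | h
      · have hkn : (k + 1 : ℝ) ≤ n := by exact_mod_cast h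
        have : 0 ≤ (n : ℝ) - (k + 1) * α := by nlinarith
        exact add_nonneg (mul_nonneg this (ih _)) hb
      · rw [genFacCoeff_eq_zero_of_lt α hn h]
        simpa using hb

theorem genFacCoeff_one_right_pos {α : ℝ} (hα : α ∈ Set.Ioo (0 : ℝ) 1) {n : ℕ} (hn : 1 ≤ n) :
    0 < genFacCoeff n 1 α := by
  refine lt_of_le_of_ne (genFacCoeff_nonneg hα hn 1) ?_
  rw [genFacCoeff_one_right]
  exact (neg_ne_zero.mpr (risingFac_neg_ne_zero hα n)).symm

/-- A bound on the generalized factorial coefficients that is uniform in `n` relative to the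
coefficient with `k = 1`. -/
theorem genFacCoeff_le {α : ℝ} (hα : α ∈ Set.Ioo (0 : ℝ) 1) {n : ℕ} (hn : 1 ≤ n) (k : ℕ) :
    genFacCoeff n (k + 1) α ≤
      genFacCoeff n 1 α * ((1 / (1 - α)) ^ k / (Nat.factorial k : ℝ)) := by
  have h0 := hα.1
  have h1 := hα.2
  have hα1 : 0 < 1 - α := by linarith
  obtain ⟨B, hB⟩ : ∃ B, B = 1 / (1 - α) := ⟨_, rfl⟩
  rw [← hB]
  have hB1 : 1 ≤ B := by rw [hB, le_div_iff₀ hα1]; linarith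
  have hBα : B * (1 - α) = 1 := by rw [hB]; field_simp
  induction n, hn using Nat.le_induction generalizing k with
  | base =>
    rcases k with _ | k
    · simp
    · rw [genFacCoeff_eq_zero_of_lt α le_rfl (by omega)]
      have := genFacCoeff_nonneg hα le_rfl 1
      positivity
  | succ n hn ih =>
    have hA := genFacCoeff_one_right_pos hα hn
    have hn1 : (1 : ℝ) ≤ n := by exact_mod_cast hn
    have hrec : genFacCoeff (n + 1) 1 α = (n - α) * genFacCoeff n 1 α := by
      rw [genFacCoeff_succ_succ n 0, genFacCoeff_zero_right]; simp
    rcases k with _ | k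
    · simp
    · rw [hrec, genFacCoeff_succ_succ]
      set A := genFacCoeff n 1 α
      have hk : (0 : ℝ) < Nat.factorial k := by positivity
      have hpow : (0 : ℝ) < B ^ k := by positivity
      obtain ⟨q, hq⟩ : ∃ q, q = A * (B ^ k / (Nat.factorial (k + 1) : ℝ)) := ⟨_, rfl⟩
      have hq0 : 0 < q := by rw [hq]; positivity
      have e1 : A * (B ^ k / (Nat.factorial k : ℝ)) = (k + 1) * q := by
        rw [hq, Nat.factorial_succ]; push_cast; field_simp
      have e2 : A * (B ^ (k + 1) / (Nat.factorial (k + 1) : ℝ)) = B * q := by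
        rw [hq, pow_succ]; ring
      have i1 := ih k
      have i2 := ih (k + 1)
      rw [e1] at i1
      rw [e2] at i2
      rw [mul_assoc, e2]
      have hk0 : (0 : ℝ) ≤ k := by positivity
      have j1 := mul_le_mul_of_nonneg_left i1 h0.le
      rcases le_or_gt (k + 1 + 1) n with h | h
      · have hkn : (k + 1 + 1 : ℝ) ≤ n := by exact_mod_cast h
        have hc : 0 ≤ (n : ℝ) - (k + 1 + 1) * α := by nlinarith
        have j2 := mul_le_mul_of_nonneg_left i2 hc
        push_cast
        have : α * ((k + 1) * q) ≤ α * ((k + 1) * (B * q)) := by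
          gcongr
          nlinarith
        nlinarith
      · rw [genFacCoeff_eq_zero_of_lt α hn h, mul_zero, zero_add]
        rcases lt_or_ge n (k + 1) with h' | h'
        · rw [genFacCoeff_eq_zero_of_lt α hn h', mul_zero]
          have : 0 ≤ (n : ℝ) - α := by linarith
          positivity
        · obtain rfl : n = k + 1 := by omega
          push_cast at *
          have : α * (k + 1) ≤ (k + 1 - α) * B := by nlinarith
          nlinarith

theorem tendsto_risingFac_div_zero {α : ℝ} (hα : α ∈ Set.Ioo (0 : ℝ) 1) {i : ℕ} (hi : 2 ≤ i) :
    Tendsto (fun n : ℕ => risingFac (-(i : ℝ) * α) n 1 / risingFac (-α) n 1) atTop (𝓝 0) := by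
  have h0 := hα.1
  have h1 := hα.2
  set x : ℕ → ℝ := fun n => risingFac (-(i : ℝ) * α) n 1 / risingFac (-α) n 1 with hx
  obtain ⟨c, hc⟩ : ∃ c, c = ((i : ℝ) - 1) * α := ⟨_, rfl⟩
  have hi2 : (2 : ℝ) ≤ i := by exact_mod_cast hi
  have hc0 : 0 < c := by rw [hc]; exact mul_pos (by linarith) h0
  set S : ℕ → ℝ := fun n => ∑ j ∈ Finset.range n, 1 / ((j : ℝ) + 1) with hS
  have hStop : Tendsto S atTop atTop := Real.tendsto_sum_range_one_div_nat_succ_atTop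
  obtain ⟨N, hN⟩ := exists_nat_ge (c + 1)
  have hbound : ∀ n, N ≤ n → |x n| ≤ |x N| * exp (c * S N) * exp (-(c * S n)) := by
    intro n hn
    induction n, hn using Nat.le_induction with
    | base => rw [mul_assoc, ← Real.exp_add]; simp
    | succ n hn ih =>
      have hnN : (N : ℝ) ≤ n := by exact_mod_cast hn
      have hd : 0 < (n : ℝ) - α := by linarith
      have hstep : x (n + 1) = x n * (1 - c / (n - α)) := by
        have hne := risingFac_neg_ne_zero hα n
        have hd' : -α + (n : ℝ) ≠ 0 := by linarith
        simp only [hx]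
        rw [risingFac_succ, risingFac_succ, mul_div_mul_comm, hc]
        congr 1
        rw [show (n : ℝ) - α = -α + n by ring]
        field_simp
        ring
      have hle1 : c / (n - α) ≤ 1 := by rw [div_le_one hd]; linarith
      have hle2 : c * (1 / (n + 1)) ≤ c / (n - α) := by
        rw [mul_one_div]
        exact div_le_div_of_nonneg_left hc0.le hd (by linarith)
      have hle3 : 1 - c / (n - α) ≤ exp (-(c * (1 / (n + 1)))) := by
        have := Real.add_one_le_exp (-(c * (1 / ((n : ℝ) + 1))))
        linarith
      have hSs : S (n + 1) = S n + 1 / (n + 1) := by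
        simp only [hS]; rw [Finset.sum_range_succ]
      rw [hstep, abs_mul, abs_of_nonneg (by linarith : 0 ≤ 1 - c / ((n : ℝ) - α)), hSs, mul_add,
        neg_add, Real.exp_add, ← mul_assoc]
      exact mul_le_mul ih hle3 (by linarith) (by positivity)
  have hlim : Tendsto (fun n => |x N| * exp (c * S N) * exp (-(c * S n))) atTop (𝓝 0) := by
    have : Tendsto (fun n => exp (-(c * S n))) atTop (𝓝 0) :=
      Real.tendsto_exp_neg_atTop_nhds_zero.comp (hStop.const_mul_atTop hc0)
    simpa using this.const_mul (|x N| * exp (c * S N))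
  refine squeeze_zero_norm' ?_ hlim
  filter_upwards [eventually_ge_atTop N] with n hn
  simpa using hbound n hn

theorem tendsto_genFacCoeff_div {α : ℝ} (hα : α ∈ Set.Ioo (0 : ℝ) 1) (k : ℕ) :
    Tendsto (fun n : ℕ => genFacCoeff n (k + 1) α / genFacCoeff n 1 α) atTop
      (𝓝 (1 / (Nat.factorial k : ℝ))) := by
  have hterm : ∀ i ∈ Finset.Icc 1 (k + 1), Tendsto (fun n : ℕ =>
      (-1 : ℝ) ^ i * (Nat.choose (k + 1) i : ℝ) *
        (risingFac (-(i : ℝ) * α) n 1 / risingFac (-α) n 1)) atTop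
      (𝓝 (if i = 1 then -(k + 1 : ℝ) else 0)) := by
    intro i hi
    have hi1 := (Finset.mem_Icc.mp hi).1
    split_ifs with h
    · subst h
      have : ∀ n, risingFac (-((1 : ℕ) : ℝ) * α) n 1 / risingFac (-α) n 1 = 1 := by
        intro n
        simpa using div_self (risingFac_neg_ne_zero hα n)
      simp only [this]
      simp
    · simpa using (tendsto_risingFac_div_zero hα (by omega : 2 ≤ i)).const_mul
        ((-1 : ℝ) ^ i * (Nat.choose (k + 1) i : ℝ))
  have hsum := (tendsto_finsetSum _ hterm).const_mul (-(1 / (Nat.factorial (k + 1) : ℝ)))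
  have hval : -(1 / (Nat.factorial (k + 1) : ℝ)) *
      ∑ i ∈ Finset.Icc 1 (k + 1), (if i = 1 then -(k + 1 : ℝ) else 0) =
      1 / (Nat.factorial k : ℝ) := by
    rw [Finset.sum_ite_eq', if_pos (by simp), Nat.factorial_succ]
    have : (Nat.factorial k : ℝ) ≠ 0 := by positivity
    push_cast
    field_simp
  rw [hval] at hsum
  refine hsum.congr fun n => ?_
  rw [genFacCoeff_one_right, genFacCoeff]
  simp only [← mul_div_assoc, ← Finset.sum_div]
  rw [div_neg]
  ring

/-- The generating polynomial of the generalized factorial coefficients, normalized by its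
linear coefficient, converges to `w * exp w`. -/
theorem tendsto_sum_genFacCoeff_mul_pow_div {α : ℝ} (hα : α ∈ Set.Ioo (0 : ℝ) 1) (w : ℝ) :
    Tendsto (fun n : ℕ =>
        (∑ k ∈ Finset.Icc 1 n, genFacCoeff n k α * w ^ k) / genFacCoeff n 1 α)
      atTop (𝓝 (w * exp w)) := by
  have hexp : ∑' k : ℕ, 1 / (Nat.factorial k : ℝ) * w ^ (k + 1) = w * exp w := by
    have : HasSum (fun k : ℕ => w ^ k / (Nat.factorial k : ℝ)) (exp w) := by
      rw [Real.exp_eq_exp_ℝ]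
      exact NormedSpace.expSeries_div_hasSum_exp w
    rw [← (this.mul_left w).tsum_eq]
    refine tsum_congr fun k => ?_
    ring
  have hsummable : Summable (fun k : ℕ =>
      (1 / (1 - α)) ^ k / (Nat.factorial k : ℝ) * |w| ^ (k + 1)) := by
    refine ((Real.summable_pow_div_factorial (1 / (1 - α) * |w|)).mul_left |w|).congr fun k => ?_
    rw [mul_pow]; ring
  have hlim := tendsto_tsum_of_dominated_convergence (𝓕 := atTop)
    (f := fun (n k : ℕ) => genFacCoeff n (k + 1) α / genFacCoeff n 1 α * w ^ (k + 1))
    hsummable (fun k => (tendsto_genFacCoeff_div hα k).mul_const (w ^ (k + 1))) (by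
      filter_upwards [eventually_ge_atTop 1] with n hn k
      have hA := genFacCoeff_one_right_pos hα hn
      have hC := genFacCoeff_nonneg hα hn (k + 1)
      rw [norm_mul, norm_pow, Real.norm_eq_abs, Real.norm_eq_abs,
        abs_of_nonneg (div_nonneg hC hA.le)]
      refine mul_le_mul_of_nonneg_right ?_ (by positivity)
      rw [div_le_iff₀' hA]
      exact genFacCoeff_le hα hn k)
  rw [hexp] at hlim
  refine hlim.congr' ?_
  filter_upwards [eventually_ge_atTop 1] with n hn
  rw [tsum_eq_sum (s := Finset.range n), Finset.sum_div, Finset.range_eq_Ico,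
    Finset.sum_Ico_add' (fun k => genFacCoeff n k α / genFacCoeff n 1 α * w ^ k) 0 n 1]
  · refine Finset.sum_congr (by ext; simp) fun k _ => ?_
    ring
  · intro k hk
    rw [Finset.mem_range, not_lt] at hk
    rw [genFacCoeff_eq_zero_of_lt α hn (by omega)]
    simp

theorem stmt5 (α z : ℝ) (hα : α ∈ Set.Ioo (0 : ℝ) 1) (hz : 0 < z) (s : ℝ) (hs : 0 < s) :
    Tendsto (fun n : ℕ =>
        (∑ k ∈ Finset.Icc 1 n, genFacCoeff n k α * (z * s) ^ k) /
          (∑ k ∈ Finset.Icc 1 n, genFacCoeff n k α * z ^ k))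
      atTop (𝓝 (s * Real.exp (z * (s - 1)))) := by
  have hlim := (tendsto_sum_genFacCoeff_mul_pow_div hα (z * s)).div
    (tendsto_sum_genFacCoeff_mul_pow_div hα z) (by positivity)
  have hval : z * s * exp (z * s) / (z * exp z) = s * exp (z * (s - 1)) := by
    rw [mul_sub, mul_one, Real.exp_sub]
    field_simp
  rw [hval] at hlim
  refine hlim.congr' ?_
  filter_upwards [eventually_ge_atTop 1] with n hn
  exact div_div_div_cancel_right₀ (genFacCoeff_one_right_pos hα hn).ne' _ _
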